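/- Let p ≡ 1 (mod 4) be prime and set δ = 1 if p ≡ 1 (mod 3) and δ = 2 if p ≡ 2 (mod 3). Let T1, T2 be nonnegative integers with T1 ≥ 1, and suppose the Legendre symbol (x/p) = (3/p) for all x with a1 ≤ x ≤ (p−δ)/3 + T2 and for all x with a2 ≤ x ≤ (2p+δ)/3 + (T1−1), where a1 := (p−δ)/3 − (T1−1) and a2 := (2p+δ)/3 − T2. Suppose n ≥ 2 and one of the following holds: (i) n ≡ 0 (mod 3), 3p/(3T1+δ) < n < 3p/(3T1+δ−3), i := a1·n − (n/3 − 1)·p; (ii) n ≡ 0 (mod 3), 3p/(3T2+3−δ) < n < 3p/(3T2−δ), i := a2·n − (2n/3 − 1)·p; (iii) n ≡ 2 (mod 3), T1 ≤ 2T2+2−δ, 2p/(3T1+δ) < n < 2p/(3T1+δ−3), i := a1·n − ((n−2)/3)·p; (iv) n ≡ 2 (mod 3), T1 ≥ 2T2+2−δ, p/(3T2+3−δ) < n < p/(3T2−δ), i := a2·n − ((2n−1)/3)·p; (v) n ≡ 1 (mod 3), T2 ≥ 2T1−1+δ, p/(3T1+δ) < n < p/(3T1+δ−3), i := a1·n −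 ((n−1)/3)·p; (vi) n ≡ 1 (mod 3), T2 ≤ 2T1−1+δ, 2p/(3T2+3−δ) < n < 2p/(3T2−δ), i := a2·n − ((2n−2)/3)·p. Then the map f(x) = ((3n/p)·x^{(p+1)/2} mod p) satisfies f(x) = x for every x ∈ I_i, i.e., f is the identity map on I_i. -/

import Mathlib

/-- `IclassZ p n i` is the residue class `I_i = {x : 1 ≤ x ≤ p-1, x ≡ i (mod n)}`
for an integer `i`. -/
def IclassZ (p n : ℕ) (i : ℤ) : Finset ℕ :=
  (Finset.Icc 1 (p - 1)).filter fun x => (x : ℤ) % (n : ℤ) = i % (n : ℤ)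

/-- `fmap p A k x` is `A x^k mod p`, the least residue in `{0, …, p-1}`. -/
def fmap (p : ℕ) (A : ℤ) (k : ℕ) (x : ℕ) : ℕ :=
  ((A : ZMod p) * (x : ZMod p) ^ k).val

/-- If `x` and `A` have the same quadratic character modulo `p`, then `x` is a fixed point of
`x ↦ (A/p) x^((p+1)/2) mod p`. -/
theorem fmap_legendreSym_eq_self (p : ℕ) [Fact p.Prime] (hodd : p % 2 = 1) (A : ℤ) (x : ℕ)
    (hx : 1 ≤ x) (hxp : x < p) (h : legendreSym p x = legendreSym p A) :
    fmap p (legendreSym p A) ((p + 1) / 2) x = x := by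
  have hx0 : (((x : ℕ) : ℤ) : ZMod p) ≠ 0 := by
    rw [Int.cast_natCast, Ne, ZMod.natCast_eq_zero_iff]
    exact Nat.not_dvd_of_pos_of_lt hx hxp
  have hsq := legendreSym.sq_one p hx0
  have hpow := legendreSym.eq_pow p (x : ℤ)
  rw [Int.cast_natCast] at hpow
  have hsq' : ((legendreSym p x : ℤ) : ZMod p) ^ 2 = 1 := by
    rw [← Int.cast_pow, hsq, Int.cast_one]
  have hexp : (p + 1) / 2 = p / 2 + 1 := by omega
  have hval : ((legendreSym p A : ℤ) : ZMod p) * (x : ZMod p) ^ ((p + 1) / 2) = x := by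
    rw [← h, hexp, pow_succ, ← hpow]
    linear_combination (x : ZMod p) * hsq'
  rw [fmap, hval, ZMod.val_natCast, Nat.mod_eq_of_lt hxp]

/-- If `x = n y - m p` and `(y/p) = (3/p)`, then `(x/p) = (3n/p)`. -/
theorem legendreSym_eq_of_eq_mul_sub (p : ℕ) [Fact p.Prime] (n y : ℕ) (x m : ℤ)
    (hxy : x = n * y - m * p) (hy : legendreSym p y = legendreSym p 3) :
    legendreSym p x = legendreSym p (3 * n) := by
  rw [legendreSym.mod, hxy, Int.sub_mul_emod_self_right, ← legendreSym.mod, legendreSym.mul,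
    legendreSym.mul, hy, mul_comm]

/-- If `x = n y - m p` with `0 < x < p`, then `y` is confined to `[m p / n, (m + 1) p / n]`. -/
theorem mem_Icc_of_eq_mul_sub {n p x y m a b : ℤ} (hn : 0 < n) (hxy : x = n * y - m * p)
    (hx : 0 < x) (hxp : x < p) (ha : n * (a - 1) ≤ m * p) (hb : (m + 1) * p ≤ n * (b + 1)) :
    a ≤ y ∧ y ≤ b := by
  have h1 : a - 1 < y := lt_of_mul_lt_mul_left (by linarith) hn.le
  have h2 : y < b + 1 := lt_of_mul_lt_mul_left (by linarith) hn.le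
  omega

theorem stmt_10 (p T1 T2 n : ℕ) [hp : Fact p.Prime] (hp4 : p % 4 = 1) (hT1 : 1 ≤ T1)
    (hn : 2 ≤ n)
    (δ : ℤ) (hδ : δ = if p % 3 = 1 then 1 else 2)
    (a1 a2 : ℤ)
    (ha1 : a1 = ((p : ℤ) - δ) / 3 - ((T1 : ℤ) - 1))
    (ha2 : a2 = (2 * (p : ℤ) + δ) / 3 - (T2 : ℤ))
    (hleg1 : ∀ x : ℕ, a1 ≤ (x : ℤ) → (x : ℤ) ≤ ((p : ℤ) - δ) / 3 + (T2 : ℤ) →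
      legendreSym p x = legendreSym p 3)
    (hleg2 : ∀ x : ℕ, a2 ≤ (x : ℤ) → (x : ℤ) ≤ (2 * (p : ℤ) + δ) / 3 + ((T1 : ℤ) - 1) →
      legendreSym p x = legendreSym p 3)
    (i : ℤ)
    (hcase :
      (n % 3 = 0 ∧ 3 * (p : ℤ) < (n : ℤ) * (3 * (T1 : ℤ) + δ) ∧
        (n : ℤ) * (3 * (T1 : ℤ) + δ - 3) < 3 * (p : ℤ) ∧
        i = a1 * (n : ℤ) - ((n : ℤ) / 3 - 1) * (p : ℤ)) ∨
      (n % 3 = 0 ∧ 3 * (p : ℤ) < (n : ℤ) * (3 * (T2 : ℤ) + 3 - δ) ∧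
        (n : ℤ) * (3 * (T2 : ℤ) - δ) < 3 * (p : ℤ) ∧
        i = a2 * (n : ℤ) - (2 * (n : ℤ) / 3 - 1) * (p : ℤ)) ∨
      (n % 3 = 2 ∧ (T1 : ℤ) ≤ 2 * (T2 : ℤ) + 2 - δ ∧
        2 * (p : ℤ) < (n : ℤ) * (3 * (T1 : ℤ) + δ) ∧
        (n : ℤ) * (3 * (T1 : ℤ) + δ - 3) < 2 * (p : ℤ) ∧
        i = a1 * (n : ℤ) - (((n : ℤ) - 2) / 3) * (p : ℤ)) ∨
      (n % 3 = 2 ∧ 2 * (T2 : ℤ) + 2 - δ ≤ (T1 : ℤ) ∧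
        (p : ℤ) < (n : ℤ) * (3 * (T2 : ℤ) + 3 - δ) ∧
        (n : ℤ) * (3 * (T2 : ℤ) - δ) < (p : ℤ) ∧
        i = a2 * (n : ℤ) - ((2 * (n : ℤ) - 1) / 3) * (p : ℤ)) ∨
      (n % 3 = 1 ∧ 2 * (T1 : ℤ) - 1 + δ ≤ (T2 : ℤ) ∧
        (p : ℤ) < (n : ℤ) * (3 * (T1 : ℤ) + δ) ∧
        (n : ℤ) * (3 * (T1 : ℤ) + δ - 3) < (p : ℤ) ∧
        i = a1 * (n : ℤ) - (((n : ℤ) - 1) / 3) * (p : ℤ)) ∨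
      (n % 3 = 1 ∧ (T2 : ℤ) ≤ 2 * (T1 : ℤ) - 1 + δ ∧
        2 * (p : ℤ) < (n : ℤ) * (3 * (T2 : ℤ) + 3 - δ) ∧
        (n : ℤ) * (3 * (T2 : ℤ) - δ) < 2 * (p : ℤ) ∧
        i = a2 * (n : ℤ) - ((2 * (n : ℤ) - 2) / 3) * (p : ℤ))) :
    ∀ x ∈ IclassZ p n i, fmap p (legendreSym p (3 * n)) ((p + 1) / 2) x = x := by
  have hp3 : p % 3 = 1 ∨ p % 3 = 2 := by
    have : ¬ 3 ∣ p := fun hd => by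
      have := (Nat.prime_dvd_prime_iff_eq Nat.prime_three hp.out).mp hd
      omega
    omega
  obtain ⟨q, hq, hδ'⟩ : ∃ q : ℤ, (p : ℤ) = 3 * q + δ ∧ (δ = 1 ∨ δ = 2) := by
    refine ⟨(p : ℤ) / 3, ?_⟩
    rcases hp3 with h | h <;> simp only [h] at hδ <;> norm_num at hδ <;> omega
  have hq1 : ((p : ℤ) - δ) / 3 = q := by omega
  have hq2 : (2 * (p : ℤ) + δ) / 3 = 2 * q + δ := by omega
  rw [hq1] at ha1 hleg1
  rw [hq2] at ha2 hleg2
  intro x hx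
  rw [IclassZ, Finset.mem_filter, Finset.mem_Icc] at hx
  obtain ⟨⟨hx1, hxp⟩, hxi⟩ := hx
  have hxp' : x < p := by omega
  refine fmap_legendreSym_eq_self p (by omega) _ x hx1 hxp' ?_
  have hn0 : (0 : ℤ) < n := by omega
  have hx1' : (1 : ℤ) ≤ x := by exact_mod_cast hx1
  have hxp'' : (x : ℤ) < p := by exact_mod_cast hxp'
  obtain ⟨k, hk⟩ : (n : ℤ) ∣ x - i := Int.ModEq.dvd (Eq.symm hxi)
  suffices H : ∃ y m : ℤ, 0 ≤ m ∧ (x : ℤ) = n * y - m * p ∧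
      ((a1 ≤ y ∧ y ≤ q + T2) ∨ (a2 ≤ y ∧ y ≤ 2 * q + δ + (T1 - 1))) by
    obtain ⟨y, m, hm, hxy, hy⟩ := H
    have hy0 : 0 ≤ y := by
      by_contra! hneg
      nlinarith [mul_nonneg hm (Int.natCast_nonneg p)]
    lift y to ℕ using hy0
    refine legendreSym_eq_of_eq_mul_sub p n y x m hxy ?_
    rcases hy with ⟨h1, h2⟩ | ⟨h1, h2⟩
    · exact hleg1 y h1 h2
    · exact hleg2 y h1 h2
  have hnp : (n : ℤ) * p = n * (3 * q + δ) := by rw [hq]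
  have hnT1 : (n : ℤ) ≤ n * T1 := le_mul_of_one_le_right hn0.le (by exact_mod_cast hT1)
  have hnT2 : 0 ≤ (n : ℤ) * T2 := by positivity
  have hnδ1 : (n : ℤ) ≤ n * δ := le_mul_of_one_le_right hn0.le (by omega)
  have hnδ2 : (n : ℤ) * δ ≤ n * 2 := mul_le_mul_of_nonneg_left (by omega) hn0.le
  rcases hcase with ⟨hr, hlo, hhi, hi⟩ | ⟨hr, hlo, hhi, hi⟩ | ⟨hr, hT, hlo, hhi, hi⟩ |
    ⟨hr, hT, hlo, hhi, hi⟩ | ⟨hr, hT, hlo, hhi, hi⟩ | ⟨hr, hT, hlo, hhi, hi⟩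
  · obtain ⟨m, hm⟩ : ∃ m : ℤ, m = (n : ℤ) / 3 - 1 := ⟨_, rfl⟩
    have hm3 : (n : ℤ) - 3 = 3 * m := by omega
    have hmp : ((n : ℤ) - 3) * (p : ℤ) = 3 * m * p := by rw [hm3]
    rw [← hm] at hi
    have hxy : (x : ℤ) = n * (a1 + k) - m * p := by linear_combination hk + hi
    refine ⟨a1 + k, m, by omega, hxy, Or.inl ?_⟩
    refine mem_Icc_of_eq_mul_sub hn0 hxy (by omega) hxp'' ?_ ?_
    · rw [ha1]; linarith
    · linarith
  · obtain ⟨m, hm⟩ : ∃ m : ℤ, m = 2 * (n : ℤ) / 3 - 1 := ⟨_, rfl⟩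
    have hm3 : 2 * (n : ℤ) - 3 = 3 * m := by omega
    have hmp : (2 * (n : ℤ) - 3) * (p : ℤ) = 3 * m * p := by rw [hm3]
    rw [← hm] at hi
    have hxy : (x : ℤ) = n * (a2 + k) - m * p := by linear_combination hk + hi
    refine ⟨a2 + k, m, by omega, hxy, Or.inr ?_⟩
    refine mem_Icc_of_eq_mul_sub hn0 hxy (by omega) hxp'' ?_ ?_
    · rw [ha2]; linarith
    · linarith
  · obtain ⟨m, hm⟩ : ∃ m : ℤ, m = ((n : ℤ) - 2) / 3 := ⟨_, rfl⟩
    have hm3 : (n : ℤ) - 2 = 3 * m := by omega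
    have hmp : ((n : ℤ) - 2) * (p : ℤ) = 3 * m * p := by rw [hm3]
    rw [← hm] at hi
    have hxy : (x : ℤ) = n * (a1 + k) - m * p := by linear_combination hk + hi
    refine ⟨a1 + k, m, by omega, hxy, Or.inl ?_⟩
    have hnT := mul_le_mul_of_nonneg_left hT hn0.le
    refine mem_Icc_of_eq_mul_sub hn0 hxy (by omega) hxp'' ?_ ?_
    · rw [ha1]; linarith
    · linarith
  · obtain ⟨m, hm⟩ : ∃ m : ℤ, m = (2 * (n : ℤ) - 1) / 3 := ⟨_, rfl⟩
    have hm3 : 2 * (n : ℤ) - 1 = 3 * m := by omega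
    have hmp : (2 * (n : ℤ) - 1) * (p : ℤ) = 3 * m * p := by rw [hm3]
    rw [← hm] at hi
    have hxy : (x : ℤ) = n * (a2 + k) - m * p := by linear_combination hk + hi
    refine ⟨a2 + k, m, by omega, hxy, Or.inr ?_⟩
    have hnT := mul_le_mul_of_nonneg_left hT hn0.le
    refine mem_Icc_of_eq_mul_sub hn0 hxy (by omega) hxp'' ?_ ?_
    · rw [ha2]; linarith
    · linarith
  · obtain ⟨m, hm⟩ : ∃ m : ℤ, m = ((n : ℤ) - 1) / 3 := ⟨_, rfl⟩
    have hm3 : (n : ℤ) - 1 = 3 * m := by omega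
    have hmp : ((n : ℤ) - 1) * (p : ℤ) = 3 * m * p := by rw [hm3]
    rw [← hm] at hi
    have hxy : (x : ℤ) = n * (a1 + k) - m * p := by linear_combination hk + hi
    refine ⟨a1 + k, m, by omega, hxy, Or.inl ?_⟩
    have hnT := mul_le_mul_of_nonneg_left hT hn0.le
    refine mem_Icc_of_eq_mul_sub hn0 hxy (by omega) hxp'' ?_ ?_
    · rw [ha1]; linarith
    · linarith
  · obtain ⟨m, hm⟩ : ∃ m : ℤ, m = (2 * (n : ℤ) - 2) / 3 := ⟨_, rfl⟩
    have hm3 : 2 * (n : ℤ) - 2 = 3 * m := by omega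
    have hmp : (2 * (n : ℤ) - 2) * (p : ℤ) = 3 * m * p := by rw [hm3]
    rw [← hm] at hi
    have hxy : (x : ℤ) = n * (a2 + k) - m * p := by linear_combination hk + hi
    refine ⟨a2 + k, m, by omega, hxy, Or.inr ?_⟩
    have hnT := mul_le_mul_of_nonneg_left hT hn0.le
    refine mem_Icc_of_eq_mul_sub hn0 hxy (by omega) hxp'' ?_ ?_
    · rw [ha2]; linarith
    · linarith
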